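/- (Rockafellar) Let B be a real Banach space and let f : B → ℝ ∪ {+∞} be proper, lower semicontinuous and convex. Then the graph of its subdifferential, G = {(u, ξ) ∈ B × B* : f(v) ≥ f(u) + ⟨ξ, v − u⟩ for all v ∈ B}, is maximal monotone: G is monotone, and every monotone subset of B × B* containing G equals G. -/

import Mathlib

open Filter Topology

/-- A subset of `B × B*` is monotone if `⟨ξ₁ − ξ₂, v₁ − v₂⟩ ≥ 0` on it. -/
def MonotoneSet {B : Type*} [NormedAddCommGroup B] [NormedSpace ℝ B]
    (A : Set (B × (B →L[ℝ] ℝ))) : Prop :=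
  ∀ p ∈ A, ∀ q ∈ A, 0 ≤ (p.2 - q.2) (p.1 - q.1)

/-- Convexity of an extended-real-valued function. -/
def ERealConvex {B : Type*} [NormedAddCommGroup B] [NormedSpace ℝ B]
    (f : B → EReal) : Prop :=
  ∀ u v : B, ∀ t : ℝ, t ∈ Set.Ioo (0 : ℝ) 1 →
    f (t • u + (1 - t) • v) ≤ ((t : ℝ) : EReal) * f u + (((1 - t : ℝ)) : EReal) * f v

/-- Ekeland's variational principle, stated for a closed set playing the role of an epigraph. -/
theorem IsClosed.exists_ekeland_point {X : Type*} [MetricSpace X] [CompleteSpace X]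
    {E : Set (X × ℝ)} (hE : IsClosed E) (hne : E.Nonempty) {c : ℝ} (hc : ∀ p ∈ E, c ≤ p.2)
    {ε : ℝ} (hε : 0 < ε) :
    ∃ p ∈ E, ∀ q ∈ E, p.2 ≤ q.2 + ε * dist q.1 p.1 := by
  obtain ⟨p₀, hp₀⟩ := hne
  have step : ∀ (n : ℕ) (p : E), ∃ q : E, q.1.2 + ε * dist q.1.1 p.1.1 ≤ p.1.2 ∧
      ∀ z ∈ E, z.2 + ε * dist z.1 p.1.1 ≤ p.1.2 → q.1.2 ≤ z.2 + (1 / 2 : ℝ) ^ n := by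
    intro n p
    let S : Set ℝ := {s | ∃ z ∈ E, z.2 + ε * dist z.1 p.1.1 ≤ p.1.2 ∧ z.2 = s}
    have hS : S.Nonempty := ⟨p.1.2, p.1, p.2, by simp, rfl⟩
    have hb : BddBelow S := ⟨c, by rintro _ ⟨z, hz, -, rfl⟩; exact hc z hz⟩
    obtain ⟨_, ⟨z, hz, hzp, rfl⟩, hlt⟩ :=
      exists_lt_of_csInf_lt hS (lt_add_of_pos_right (sInf S) (by positivity : (0 : ℝ) < (1 / 2) ^ n))
    refine ⟨⟨z, hz⟩, hzp, fun w hw hwp => ?_⟩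
    have : sInf S ≤ w.2 := csInf_le hb ⟨w, hw, hwp, rfl⟩
    dsimp only
    linarith
  choose next hnext hmin using step
  let p : ℕ → E := fun n => Nat.rec ⟨p₀, hp₀⟩ next n
  have hp : ∀ n, p (n + 1) = next n (p n) := fun _ => rfl
  have hchain : ∀ n m, n ≤ m → (p m).1.2 + ε * dist (p m).1.1 (p n).1.1 ≤ (p n).1.2 := by
    intro n m hnm
    induction m, hnm using Nat.le_induction with
    | base => simp
    | succ m _ ih =>
      have h := hnext m (p m)
      rw [← hp] at h
      have := mul_le_mul_of_nonneg_left
        (dist_triangle (p (m + 1)).1.1 (p m).1.1 (p n).1.1) hε.le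
      linarith
  have hanti : Antitone fun n => (p n).1.2 := by
    intro n m hnm
    have := hchain n m hnm
    have := mul_nonneg hε.le (dist_nonneg (x := (p m).1.1) (y := (p n).1.1))
    dsimp only
    linarith
  have hlim := tendsto_atTop_ciInf hanti ⟨c, by rintro _ ⟨n, rfl⟩; exact hc _ (p n).2⟩
  set r := ⨅ n, (p n).1.2
  have hr : ∀ n, r ≤ (p n).1.2 := fun n => hanti.le_of_tendsto hlim n
  have hcauchy : CauchySeq fun n => (p n).1.1 := by
    refine cauchySeq_of_le_tendsto_0' (fun n => ((p n).1.2 - r) / ε) (fun n m hnm => ?_) ?_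
    · rw [le_div_iff₀ hε, dist_comm]
      have := hchain n m hnm
      have := hr m
      linarith
    · simpa using (hlim.sub_const r).div_const ε
  obtain ⟨u, hu⟩ := cauchySeq_tendsto_of_complete hcauchy
  have hlimit : ∀ n, r + ε * dist u (p n).1.1 ≤ (p n).1.2 := fun n =>
    le_of_tendsto (hlim.add ((hu.dist tendsto_const_nhds).const_mul ε))
      (eventually_atTop.2 ⟨n, fun m hm => hchain n m hm⟩)
  refine ⟨(u, r), hE.mem_of_tendsto (hu.prodMk_nhds hlim) (.of_forall fun n => (p n).2),
    fun q hq => ?_⟩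
  by_contra! hlt
  dsimp only at hlt
  have hle : r ≤ q.2 := by
    have hpow : Tendsto (fun n : ℕ => q.2 + (1 / 2 : ℝ) ^ n) atTop (𝓝 (q.2 + 0)) :=
      (tendsto_pow_atTop_nhds_zero_of_lt_one (by norm_num) (by norm_num)).const_add _
    rw [add_zero] at hpow
    refine ge_of_tendsto' hpow fun n => (hr (n + 1)).trans ?_
    rw [hp]
    refine hmin n (p n) q hq ?_
    have := mul_le_mul_of_nonneg_left (dist_triangle q.1 u (p n).1.1) hε.le
    have := hlimit n
    linarith
  have := mul_nonneg hε.le (dist_nonneg (x := q.1) (y := u))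
  linarith

section Epigraph

variable {B : Type*} [NormedAddCommGroup B] [NormedSpace ℝ B] {E : Set (B × ℝ)}

theorem ContinuousLinearMap.apply_prod_real (φ : B × ℝ →L[ℝ] ℝ) (v : B) (r : ℝ) :
    φ (v, r) = φ.comp (.inl ℝ B ℝ) v + φ (0, 1) * r := by
  have h : ((v, r) : B × ℝ) = (v, 0) + r • (0, 1) := by simp
  rw [h, map_add, map_smul]
  simp [mul_comm]

/-- A closed convex set which is not a whole vertical line over some point has an affine
minorant. -/
theorem Convex.exists_linear_minorant (hE : IsClosed E) (hconv : Convex ℝ E) {x : B} {r₀ r₁ : ℝ}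
    (hr : r₀ < r₁) (h₁ : (x, r₁) ∈ E) (h₀ : (x, r₀) ∉ E) :
    ∃ K c : ℝ, ∀ p ∈ E, c - K * ‖p.1‖ ≤ p.2 := by
  obtain ⟨φ, a, ha, hφ⟩ := geometric_hahn_banach_point_closed hconv hE h₀
  set α := φ (0, 1)
  set l := φ.comp (.inl ℝ B ℝ)
  have hform : ∀ v r, φ (v, r) = l v + α * r := φ.apply_prod_real
  have hα : 0 < α := by
    have h := ha.trans (hφ _ h₁)
    rw [hform, hform] at h
    by_contra! hneg
    nlinarith
  refine ⟨‖l‖ / α, a / α, fun p hp => ?_⟩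
  have h := hφ p hp
  rw [← Prod.mk.eta (p := p), hform] at h
  have hl := (le_abs_self _).trans (l.le_opNorm p.1)
  rw [div_mul_eq_mul_div, ← sub_div, div_le_iff₀ hα]
  linarith

/-- Sandwich theorem: a minimum of the sum of a convex function (given by its epigraph) and a
continuous convex function yields opposite subgradients. -/
theorem Convex.exists_subgradient_of_isMin (hconv : Convex ℝ E) {h : B → ℝ}
    (hcont : Continuous h) (hh : ConvexOn ℝ Set.univ h) {u : B} {r : ℝ} (hu : (u, r) ∈ E)
    (hmin : ∀ p ∈ E, r + h u ≤ p.2 + h p.1) :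
    ∃ ξ : B →L[ℝ] ℝ, (∀ p ∈ E, r + ξ (p.1 - u) ≤ p.2) ∧ ∀ v, h u - ξ (v - u) ≤ h v := by
  let H : Set (B × ℝ) := {p | p.2 + h p.1 < r + h u}
  have hHo : IsOpen H := isOpen_lt (by fun_prop) (by fun_prop)
  have hHc : Convex ℝ H := by
    intro p hp q hq a b ha hb hab
    have h1 := hh.2 (Set.mem_univ p.1) (Set.mem_univ q.1) ha hb hab
    simp only [smul_eq_mul] at h1
    simp only [H, Set.mem_ofPred_eq, Prod.snd_add, Prod.smul_snd, Prod.fst_add, Prod.smul_fst,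
      smul_eq_mul] at hp hq ⊢
    obtain rfl : b = 1 - a := by linarith
    rcases ha.eq_or_lt with rfl | ha
    · simp only [zero_smul, zero_add, sub_zero, one_smul, zero_mul, one_mul]
      exact hq
    · nlinarith
  have hdisj : Disjoint H E := Set.disjoint_left.2 fun p hp hpE => (hmin p hpE).not_gt hp
  obtain ⟨φ, a, hlt, hle⟩ := geometric_hahn_banach_open hHc hHo hconv hdisj
  set α := φ (0, 1)
  set l := φ.comp (.inl ℝ B ℝ)
  have hform : ∀ v r, φ (v, r) = l v + α * r := φ.apply_prod_real
  have hua := hle _ hu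
  rw [hform] at hua
  have hH : ∀ v, ∀ η > 0, l v + α * (r + h u - h v - η) < a := by
    intro v η hη
    rw [← hform]
    refine hlt _ ?_
    simp only [H, Set.mem_ofPred_eq]
    linarith
  have hα : 0 < α := by
    have := hH u 1 one_pos
    linarith
  have hH' : ∀ v, l v + α * (r + h u - h v) ≤ a := by
    intro v
    refine le_of_forall_pos_lt_add fun η hη => ?_
    have := hH v (η / α) (by positivity)
    rw [mul_sub, mul_div_cancel₀ _ hα.ne'] at this
    linarith
  refine ⟨-(α⁻¹ • l), fun p hp => ?_, fun v => ?_⟩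
  · have h1 := hle p hp
    have h2 := hH' u
    rw [← Prod.mk.eta (p := p), hform] at h1
    simp only [neg_apply, smul_apply, smul_eq_mul, map_sub]
    have : p.2 - (r + -(α⁻¹ * (l p.1 - l u))) = α⁻¹ * (l p.1 + α * p.2 - l u - α * r) := by
      field_simp
      ring
    have := mul_nonneg (inv_pos.2 hα).le (by linarith : 0 ≤ l p.1 + α * p.2 - l u - α * r)
    linarith
  · have h1 := hH' v
    have h2 := hH' u
    have h3 := hle _ hu
    rw [hform] at h3
    simp only [neg_apply, smul_apply, smul_eq_mul, map_sub]
    have : h v - (h u - -(α⁻¹ * (l v - l u)))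
        = α⁻¹ * (l u + α * r - l v - α * (r + h u - h v)) := by
      field_simp
      ring
    have := mul_nonneg (inv_pos.2 hα).le
      (by linarith : 0 ≤ l u + α * r - l v - α * (r + h u - h v))
    linarith

variable [CompleteSpace B]

/-- If every subgradient of a closed proper convex function (given by its epigraph `E`) is
nonnegative on its base point, then there are approximate minimizers of
`f + ‖·‖² / 2` arbitrarily close to the origin. -/
theorem Convex.exists_norm_le_of_subgradient_nonneg (hE : IsClosed E) (hconv : Convex ℝ E)
    {x : B} {r₀ r₁ : ℝ} (hr : r₀ < r₁) (h₁ : (x, r₁) ∈ E) (h₀ : (x, r₀) ∉ E)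
    (hsub : ∀ p ∈ E, ∀ ξ : B →L[ℝ] ℝ, (∀ q ∈ E, p.2 + ξ (q.1 - p.1) ≤ q.2) → 0 ≤ ξ p.1)
    {ε : ℝ} (hε : 0 < ε) :
    ∃ p ∈ E, ‖p.1‖ ≤ 2 * ε ∧ ∀ q ∈ E, p.2 ≤ q.2 + ‖q.1‖ ^ 2 / 2 + ε * ‖q.1 - p.1‖ := by
  obtain ⟨K, c, hKc⟩ := hconv.exists_linear_minorant hE hr h₁ h₀
  obtain ⟨⟨u, s⟩, hu, hmin⟩ := IsClosed.exists_ekeland_point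
    (E := {p : B × ℝ | (p.1, p.2 - ‖p.1‖ ^ 2 / 2) ∈ E}) (c := c - K ^ 2 / 2)
    (hE.preimage (by fun_prop)) ⟨(x, r₁ + ‖x‖ ^ 2 / 2), by simpa using h₁⟩
    (fun p hp => by
      have := hKc _ hp
      dsimp only at this
      nlinarith [sq_nonneg (‖p.1‖ - K)]) hε
  rw [Set.mem_ofPred_eq] at hu
  dsimp only at hu hmin
  have hmin' : ∀ q ∈ E, s ≤ q.2 + ‖q.1‖ ^ 2 / 2 + ε * ‖q.1 - u‖ := fun q hq => by
    simpa [dist_eq_norm] using hmin (q.1, q.2 + ‖q.1‖ ^ 2 / 2) (by simpa using hq)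
  refine ⟨_, hu, ?_, fun q hq => ?_⟩
  · have hh : ConvexOn ℝ Set.univ fun v : B => ‖v‖ ^ 2 / 2 + ε * ‖v - u‖ := by
      have hsq : ConvexOn ℝ Set.univ fun v : B => ‖v‖ ^ 2 :=
        convexOn_univ_norm.pow (fun _ _ => norm_nonneg _) 2
      have hd : ConvexOn ℝ Set.univ fun v : B => ‖v - u‖ := by
        simpa [dist_eq_norm] using convexOn_univ_dist u
      refine ((hsq.smul (by norm_num : (0 : ℝ) ≤ 1 / 2)).add (hd.smul hε.le)).congr fun v _ => ?_
      simp only [Pi.add_apply, smul_eq_mul]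
      ring
    obtain ⟨ξ, hξ, hξh⟩ := hconv.exists_subgradient_of_isMin (by fun_prop) hh hu
      (fun q hq => by have := hmin' q hq; simp only [sub_self, norm_zero]; linarith)
    have h0 := hsub _ hu ξ hξ
    have h1 := hξh 0
    simp only [sub_self, norm_zero, zero_sub, map_neg, norm_neg] at h0 h1
    dsimp only
    by_contra! hlt
    nlinarith [norm_nonneg u]
  · have := hmin' q hq
    have := sq_nonneg ‖u‖
    dsimp only
    linarith

/-- If every subgradient of a closed proper convex function (given by its epigraph `E`) is
nonnegative on its base point, then the function attains its minimum at the origin. -/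
theorem Convex.zero_mem_of_subgradient_nonneg (hE : IsClosed E) (hconv : Convex ℝ E)
    (hup : ∀ v r s, (v, r) ∈ E → r ≤ s → (v, s) ∈ E)
    {x : B} {r₀ r₁ : ℝ} (h₁ : (x, r₁) ∈ E) (h₀ : (x, r₀) ∉ E)
    (hsub : ∀ p ∈ E, ∀ ξ : B →L[ℝ] ℝ, (∀ q ∈ E, p.2 + ξ (q.1 - p.1) ≤ q.2) → 0 ≤ ξ p.1)
    {v : B} {s : ℝ} (hv : (v, s) ∈ E) : ((0 : B), s) ∈ E := by
  have hr : r₀ < r₁ := by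
    by_contra! h
    exact h₀ (hup _ _ _ h₁ h)
  have hquad : ∀ w t, (w, t) ∈ E → ((0 : B), t + ‖w‖ ^ 2 / 2) ∈ E := by
    intro w t hw
    let ε : ℕ → ℝ := fun n => 1 / ((n : ℝ) + 1)
    have hε : ∀ n, 0 < ε n := fun n => by positivity
    have hε0 : Tendsto ε atTop (𝓝 0) := tendsto_one_div_add_atTop_nhds_zero_nat
    choose p hpE hpn hp using fun n =>
      hconv.exists_norm_le_of_subgradient_nonneg hE hr h₁ h₀ hsub (hε n)
    have hlim : Tendsto (fun n => (p n).1) atTop (𝓝 0) :=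
      squeeze_zero_norm hpn (by simpa using hε0.const_mul 2)
    have hval : Tendsto (fun n => t + ‖w‖ ^ 2 / 2 + ε n * ‖w - (p n).1‖) atTop
        (𝓝 (t + ‖w‖ ^ 2 / 2)) := by
      simpa using (hε0.mul (hlim.const_sub w).norm).const_add (t + ‖w‖ ^ 2 / 2)
    exact hE.mem_of_tendsto (hlim.prodMk_nhds hval)
      (.of_forall fun n => hup _ _ _ (hpE n) (hp n _ hw))
  by_contra hs
  let Q : Set ℝ := {r | ((0 : B), r) ∈ E}
  have hQb : ∀ r ∈ Q, s ≤ r := by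
    intro r hr
    by_contra! h
    exact hs (hup _ _ _ hr h.le)
  have hQc : IsClosed Q := hE.preimage (by fun_prop)
  have ha : sInf Q ∈ Q := hQc.csInf_mem ⟨_, hquad _ _ hv⟩ ⟨s, hQb⟩
  set a := sInf Q
  have hsa : s < a := (hQb a ha).lt_of_ne fun h => hs (h ▸ ha)
  have hineq : ∀ t ∈ Set.Ioo (0 : ℝ) 1, a - s ≤ t * (‖v‖ ^ 2 / 2) := by
    intro t ht
    have hmem := hquad _ _ (hconv hv ha ht.1.le (sub_nonneg.2 ht.2.le) (by ring))
    have hle := csInf_le ⟨s, hQb⟩ hmem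
    simp only [Prod.smul_mk, smul_zero, add_zero, norm_smul, Real.norm_of_nonneg ht.1.le, smul_eq_mul] at hle
    refine le_of_mul_le_mul_left ?_ ht.1
    linarith [mul_pow t ‖v‖ 2]
  have hlim : Tendsto (fun t : ℝ => t * (‖v‖ ^ 2 / 2)) (𝓝[>] 0) (𝓝 0) := by
    have : Continuous fun t : ℝ => t * (‖v‖ ^ 2 / 2) := by fun_prop
    simpa using (this.tendsto 0).mono_left nhdsWithin_le_nhds
  have := ge_of_tendsto hlim
    (by filter_upwards [Ioo_mem_nhdsGT one_pos] with t ht using hineq t ht)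
  linarith

end Epigraph

theorem LowerSemicontinuous.isClosed_setOf_le_coe {X : Type*} [TopologicalSpace X] {f : X → EReal}
    (hf : LowerSemicontinuous f) : IsClosed {p : X × ℝ | f p.1 ≤ (p.2 : EReal)} :=
  hf.isClosed_epigraph.preimage
    (continuous_fst.prodMk (continuous_coe_real_ereal.comp continuous_snd))

theorem ERealConvex.convex_setOf_le_coe {B : Type*} [NormedAddCommGroup B] [NormedSpace ℝ B]
    {f : B → EReal} (hf : ERealConvex f) : Convex ℝ {p : B × ℝ | f p.1 ≤ (p.2 : EReal)} := by
  refine convex_iff_forall_pos.2 fun p hp q hq a b ha hb hab => ?_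
  obtain rfl : b = 1 - a := by linarith
  refine (hf p.1 q.1 a ⟨ha, by linarith⟩).trans ?_
  have h1 := mul_le_mul_of_nonneg_left hp (EReal.coe_nonneg.2 ha.le)
  have h2 := mul_le_mul_of_nonneg_left hq (EReal.coe_nonneg.2 hb.le)
  simpa using add_le_add h1 h2

/-- (Rockafellar) For a proper, lower semicontinuous, convex `f : B → ℝ ∪ {+∞}` on a
Banach space, the graph of the (convex-analysis) subdifferential
`G = {(u, ξ) : f(v) ≥ f(u) + ⟨ξ, v − u⟩ for all v}` is maximal monotone. -/
theorem rockafellar_subdiff_maximal_monotone {B : Type*} [NormedAddCommGroup B]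
    [NormedSpace ℝ B] [CompleteSpace B]
    (f : B → EReal)
    (hbot : ∀ x, f x ≠ ⊥) (hproper : ∃ x, f x ≠ ⊤)
    (hlsc : LowerSemicontinuous f) (hconv : ERealConvex f) :
    MonotoneSet {p : B × (B →L[ℝ] ℝ) |
        ∀ v : B, f p.1 + ((p.2 (v - p.1) : ℝ) : EReal) ≤ f v} ∧
      ∀ A : Set (B × (B →L[ℝ] ℝ)),
        {p : B × (B →L[ℝ] ℝ) |
          ∀ v : B, f p.1 + ((p.2 (v - p.1) : ℝ) : EReal) ≤ f v} ⊆ A →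
        MonotoneSet A →
        A = {p : B × (B →L[ℝ] ℝ) |
          ∀ v : B, f p.1 + ((p.2 (v - p.1) : ℝ) : EReal) ≤ f v} := by
  obtain ⟨x, hx⟩ := hproper
  have hdom : ∀ p : B × (B →L[ℝ] ℝ),
      (∀ v, f p.1 + ((p.2 (v - p.1) : ℝ) : EReal) ≤ f v) → ∃ r : ℝ, f p.1 = r := by
    intro p hp
    refine ⟨(f p.1).toReal, (EReal.coe_toReal (fun htop => hx ?_) (hbot _)).symm⟩
    have h := hp x
    rw [htop, EReal.top_add_coe] at h
    exact top_le_iff.1 h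
  refine ⟨fun p hp q hq => ?_, fun A hGA hA => (Set.Subset.antisymm hGA ?_).symm⟩
  · obtain ⟨a, ha⟩ := hdom p hp
    obtain ⟨b, hb⟩ := hdom q hq
    have h1 := hp q.1
    have h2 := hq p.1
    rw [ha, hb] at h1 h2
    norm_cast at h1 h2
    simp only [map_sub, sub_apply] at h1 h2 ⊢
    linarith
  rintro ⟨x₀, ξ₀⟩ hA₀
  let T : B × ℝ → B × ℝ := fun p => (p.1 + x₀, p.2 + ξ₀ p.1)
  let E : Set (B × ℝ) := T ⁻¹' {p | f p.1 ≤ (p.2 : EReal)}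
  have hmem : ∀ v s, (v, s) ∈ E ↔ f (v + x₀) ≤ ((s + ξ₀ v : ℝ) : EReal) := fun _ _ => Iff.rfl
  have hE : IsClosed E := hlsc.isClosed_setOf_le_coe.preimage (by fun_prop)
  have hEc : Convex ℝ E := by
    intro p hp q hq a b ha hb hab
    have hT : T (a • p + b • q) = a • T p + b • T q := by
      ext
      · simp only [T, Prod.fst_add, Prod.smul_fst, smul_add]
        nth_rewrite 1 [← one_smul ℝ x₀]
        rw [← hab, add_smul]
        abel
      · simp only [T, Prod.snd_add, Prod.smul_snd, Prod.fst_add, Prod.smul_fst, map_add, map_smul,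
          smul_eq_mul]
        ring
    change T (a • p + b • q) ∈ {p : B × ℝ | f p.1 ≤ (p.2 : EReal)}
    rw [hT]
    exact hconv.convex_setOf_le_coe hp hq ha hb hab
  obtain ⟨t, ht⟩ : ∃ t : ℝ, f x = t := ⟨_, (EReal.coe_toReal hx (hbot x)).symm⟩
  have hle : ∀ v s, (v, s) ∈ E → ((0 : B), s) ∈ E := by
    intro v s hv
    refine hEc.zero_mem_of_subgradient_nonneg hE (x := x - x₀) (r₀ := t - 1 - ξ₀ (x - x₀))
      (r₁ := t - ξ₀ (x - x₀)) (fun v r s hr hrs => ?_) ?_ ?_ ?_ hv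
    · rw [hmem] at hr ⊢
      exact hr.trans (by gcongr)
    · simp [hmem, ht]
    · rw [hmem, sub_add_cancel, sub_add_cancel, ht, EReal.coe_le_coe_iff]
      linarith
    · rintro ⟨u, r⟩ hu ξ hξ
      have hG : ∀ w, f (u + x₀) + (((ξ + ξ₀) (w - (u + x₀)) : ℝ) : EReal) ≤ f w := by
        intro w
        by_cases hw : f w = ⊤
        · simp [hw]
        obtain ⟨b, hb⟩ : ∃ b : ℝ, f w = b := ⟨_, (EReal.coe_toReal hw (hbot w)).symm⟩
        have h := hξ (w - x₀, b - ξ₀ (w - x₀)) (by simp [hmem, hb])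
        rw [hb]
        refine (add_le_add_left ((hmem u r).1 hu) _).trans ?_
        norm_cast
        simp only [map_sub, map_add, add_apply] at h ⊢
        linarith
      simpa using hA (u + x₀, ξ + ξ₀) (hGA hG) (x₀, ξ₀) hA₀
  intro w
  by_cases hw : f w = ⊤
  · simp [hw]
  obtain ⟨b, hb⟩ : ∃ b : ℝ, f w = b := ⟨_, (EReal.coe_toReal hw (hbot w)).symm⟩
  have h := hle (w - x₀) (b - ξ₀ (w - x₀)) (by simp [hmem, hb])
  rw [hmem, zero_add, map_zero, add_zero] at h
  rw [hb]
  refine (add_le_add_left h _).trans ?_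
  norm_cast
  linarith
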